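/- One-shot channel resolvability: Let 𝒲, 𝒳, 𝒴 be finite sets. Let C = {X(w)}_{w∈𝒲} be a random codebook where the X(w), w ∈ 𝒲, are drawn i.i.d. from a distribution P_X on 𝒳, and set f_C(w) = X(w). Then for every s ∈ (0,1], every distribution P_W on 𝒲, every channel P_{Y|X}, and every distribution Q_Y on 𝒴: exp(s · D_{1+s}(P_{Y|C} ‖ Q_Y | P_C)) ≤ exp(s · D_{1+s}(P_{Y|X} ‖ Q_Y | P_X) − s · H_{1+s}(P_W)) + exp(s · D_{1+s}(P_Y ‖ Q_Y)), where P_{Y|C} is induced by the joint distribution P_C P_W P_{Y|X=f_C(W)} (i.e., W ∼ P_W independent of C, and Y generated by passing f_C(W) through P_{Y|X}), and P_Y is induced by the ideal joint distribution P_X P_{Y|X}. -/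

import Mathlib

open scoped BigOperators ENNReal
open Classical

noncomputable section

/-- `p` is a probability mass function on the finite type `α`. -/
def IsDist {α : Type} [Fintype α] (p : α → ℝ) : Prop :=
  (∀ a, 0 ≤ p a) ∧ (∑ a, p a) = 1

/-- `k` is a conditional probability kernel. -/
def IsKernel {α β : Type} [Fintype β] (k : α → β → ℝ) : Prop :=
  ∀ a, (∀ b, 0 ≤ k a b) ∧ (∑ b, k a b) = 1

/-- Marginal (pushforward) of `p` along the map `f`. -/
def marg {α β : Type} [Fintype α] (f : α → β) (p : α → ℝ) : β → ℝ :=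
  fun b => ∑ a, if f a = b then p a else 0

/-- Shannon entropy (natural log). -/
def ent {α : Type} [Fintype α] (p : α → ℝ) : ℝ :=
  ∑ a, Real.negMulLog (p a)

/-- Conditional entropy `H(f(A) | g(A))` for `A ∼ p`. -/
def condEnt {α β γ : Type} [Fintype α] [Fintype β] [Fintype γ]
    (f : α → β) (g : α → γ) (p : α → ℝ) : ℝ :=
  ent (marg (fun a => (f a, g a)) p) - ent (marg g p)

/-- Kullback–Leibler divergence `D(p‖q)` with value `⊤` if `p` is not absolutely
continuous with respect to `q`. -/
def KL {α : Type} [Fintype α] (p q : α → ℝ) : ℝ≥0∞ :=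
  if ∀ a, q a = 0 → p a = 0 then ENNReal.ofReal (∑ a, p a * Real.log (p a / q a)) else ⊤


/-- `exp(s · D_{1+s}(p ‖ q)) = Σ_a p(a)^{1+s} q(a)^{-s}`, computed in `ℝ≥0∞`
(so terms with `p a = 0` contribute `0`, and `p a > 0, q a = 0` gives `⊤`). -/
def rexp {α : Type} [Fintype α] (s : ℝ) (p q : α → ℝ) : ℝ≥0∞ :=
  ∑ a, ENNReal.ofReal (p a) ^ (1 + s) * ENNReal.ofReal (q a) ^ (-s)

/-- For an i.i.d. family, coordinate `w` is independent of the remaining coordinates. -/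
theorem sum_prod_mul_split {W X : Type} [Fintype W] [DecidableEq W] [Fintype X]
    (p : X → ℝ≥0∞) (w : W) (g : X → ℝ≥0∞) (F : ({j // j ≠ w} → X) → ℝ≥0∞) :
    ∑ c : W → X, (∏ i, p (c i)) * (g (c w) * F (fun j => c j)) =
      (∑ x, p x * g x) * ∑ d : {j // j ≠ w} → X, (∏ j, p (d j)) * F d := by
  rw [Finset.sum_mul_sum, ← Fintype.sum_prod_type']
  refine Fintype.sum_equiv (Equiv.funSplitAt w X) _ _ fun c => ?_
  rw [Fintype.prod_eq_mul_prod_subtype_ne (fun i => p (c i)) w]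
  simp only [Equiv.funSplitAt_apply]
  ring

theorem sum_prod_eq_one {W X : Type} [Fintype W] [DecidableEq W] [Fintype X] (p : X → ℝ≥0∞)
    (hp : ∑ x, p x = 1) : ∑ c : W → X, ∏ i, p (c i) = 1 := by
  have h := Finset.prod_univ_sum (fun _ : W => (Finset.univ : Finset X)) (fun _ x => p x)
  rw [Fintype.piFinset_univ] at h
  rw [← h]
  simp [hp]

/-- The marginals of an i.i.d. family are the common distribution. -/
theorem sum_prod_mul_eval {W X : Type} [Fintype W] [DecidableEq W] [Fintype X] (p : X → ℝ≥0∞)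
    (hp : ∑ x, p x = 1) (w : W) (g : X → ℝ≥0∞) :
    ∑ c : W → X, (∏ i, p (c i)) * g (c w) = ∑ x, p x * g x := by
  simpa [sum_prod_eq_one p hp] using sum_prod_mul_split p w g (fun _ => 1)

/-- Jensen's inequality for the concave function `t ↦ t ^ s`, `0 < s ≤ 1`. -/
theorem sum_mul_rpow_le_rpow_sum {ι : Type} [Fintype ι] (p f : ι → ℝ≥0∞)
    (hp : ∑ i, p i = 1) {s : ℝ} (hs0 : 0 < s) (hs1 : s ≤ 1) :
    ∑ i, p i * f i ^ s ≤ (∑ i, p i * f i) ^ s := by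
  have h := ENNReal.rpow_arith_mean_le_arith_mean_rpow Finset.univ p (fun i => f i ^ s) hp
    (p := s⁻¹) ((one_le_inv₀ hs0).2 hs1)
  simp only [ENNReal.rpow_rpow_inv hs0.ne'] at h
  exact (ENNReal.rpow_inv_le_iff hs0).1 h

theorem sum_rpow_one_add_le {W : Type} [Fintype W] (a : W → ℝ≥0∞) {s : ℝ}
    (hs0 : 0 < s) (hs1 : s ≤ 1) :
    (∑ w, a w) ^ (1 + s) ≤
      ∑ w, (a w ^ (1 + s) + a w * (∑ v : {j // j ≠ w}, a v) ^ s) := by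
  have hpow (t : ℝ≥0∞) : t ^ (1 + s) = t * t ^ s := by
    rw [ENNReal.rpow_add_of_nonneg _ _ zero_le_one hs0.le, ENNReal.rpow_one]
  simp only [hpow, ← mul_add]
  rw [Finset.sum_mul]
  gcongr with w
  rw [Fintype.sum_eq_add_sum_subtype_ne a w]
  exact ENNReal.rpow_add_le_add_rpow _ _ hs0.le hs1

/-- The resolvability bound for a single channel output, with `k x = P_{Y|X}(y|x)`. -/
theorem sum_prod_mul_rpow_le {W X : Type} [Fintype W] [Fintype X] (p : X → ℝ≥0∞)
    (hp : ∑ x, p x = 1) (r : W → ℝ≥0∞) (hr : ∑ w, r w = 1) (k : X → ℝ≥0∞) {s : ℝ}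
    (hs0 : 0 < s) (hs1 : s ≤ 1) :
    ∑ c : W → X, (∏ i, p (c i)) * (∑ w, r w * k (c w)) ^ (1 + s) ≤
      (∑ x, p x * k x ^ (1 + s)) * (∑ w, r w ^ (1 + s)) + (∑ x, p x * k x) ^ (1 + s) := by
  set μ := ∑ x, p x * k x with hμ
  have diag (w : W) : ∑ c : W → X, (∏ i, p (c i)) * (r w * k (c w)) ^ (1 + s) =
      (∑ x, p x * k x ^ (1 + s)) * r w ^ (1 + s) := by
    rw [sum_prod_mul_eval p hp w (fun x => (r w * k x) ^ (1 + s)), Finset.sum_mul]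
    refine Finset.sum_congr rfl fun x _ => ?_
    rw [ENNReal.mul_rpow_of_nonneg _ _ (by linarith)]
    ring
  have off (w : W) : ∑ c : W → X, (∏ i, p (c i)) *
      (r w * k (c w) * (∑ v : {j // j ≠ w}, r v * k (c v)) ^ s) ≤ r w * μ ^ (1 + s) := by
    rw [sum_prod_mul_split p w (fun x => r w * k x)
      (fun d => (∑ v : {j // j ≠ w}, r v * k (d v)) ^ s)]
    have h1 : ∑ x, p x * (r w * k x) = r w * μ := by
      rw [hμ, Finset.mul_sum]
      exact Finset.sum_congr rfl fun x _ => by ring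
    have h2 : ∑ d : {j // j ≠ w} → X, (∏ j, p (d j)) * ∑ v : {j // j ≠ w}, r v * k (d v) ≤ μ := by
      simp only [Finset.mul_sum]
      rw [Finset.sum_comm]
      calc ∑ v : {j // j ≠ w}, ∑ d : {j // j ≠ w} → X, (∏ j, p (d j)) * (r v * k (d v))
          = ∑ v : {j // j ≠ w}, r v * μ := by
            refine Finset.sum_congr rfl fun v _ => ?_
            rw [sum_prod_mul_eval p hp v (fun x => r v * k x), hμ, Finset.mul_sum]
            exact Finset.sum_congr rfl fun x _ => by ring
        _ ≤ 1 * μ := by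
            rw [← Finset.sum_mul, ← hr, Fintype.sum_eq_add_sum_subtype_ne r w]
            gcongr
            exact le_add_self
        _ = μ := one_mul μ
    rw [h1, ENNReal.rpow_add_of_nonneg _ _ zero_le_one hs0.le, ENNReal.rpow_one, ← mul_assoc]
    gcongr
    refine (sum_mul_rpow_le_rpow_sum _ _ (sum_prod_eq_one p hp) hs0 hs1).trans ?_
    gcongr
  calc ∑ c : W → X, (∏ i, p (c i)) * (∑ w, r w * k (c w)) ^ (1 + s)
      ≤ ∑ c : W → X, (∏ i, p (c i)) * ∑ w, ((r w * k (c w)) ^ (1 + s) +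
          r w * k (c w) * (∑ v : {j // j ≠ w}, r v * k (c v)) ^ s) := by
        gcongr with c
        exact sum_rpow_one_add_le (fun w => r w * k (c w)) hs0 hs1
    _ = ∑ w, (∑ c : W → X, (∏ i, p (c i)) * (r w * k (c w)) ^ (1 + s) +
          ∑ c : W → X, (∏ i, p (c i)) *
            (r w * k (c w) * (∑ v : {j // j ≠ w}, r v * k (c v)) ^ s)) := by
        simp only [Finset.mul_sum, mul_add]
        rw [Finset.sum_comm]
        simp only [Finset.sum_add_distrib]
    _ ≤ ∑ w, ((∑ x, p x * k x ^ (1 + s)) * r w ^ (1 + s) + r w * μ ^ (1 + s)) := by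
        gcongr with w
        · exact (diag w).le
        · exact off w
    _ = (∑ x, p x * k x ^ (1 + s)) * (∑ w, r w ^ (1 + s)) + μ ^ (1 + s) := by
        rw [Finset.sum_add_distrib, ← Finset.mul_sum, ← Finset.sum_mul, hr, one_mul]

/-- A common factor of the two arguments of a Rényi summand comes out linearly. -/
theorem ofReal_mul_rpow_mul_ofReal_mul_rpow {a : ℝ} (ha : 0 ≤ a) (b q : ℝ) {s : ℝ} (hs : 0 < s) :
    ENNReal.ofReal (a * b) ^ (1 + s) * ENNReal.ofReal (a * q) ^ (-s) =
      ENNReal.ofReal a * (ENNReal.ofReal b ^ (1 + s) * ENNReal.ofReal q ^ (-s)) := by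
  have h1s : 0 < 1 + s := by linarith
  rcases ha.eq_or_lt with rfl | hpos
  · simp [ENNReal.zero_rpow_of_pos h1s]
  have ha0 : ENNReal.ofReal a ≠ 0 := (ENNReal.ofReal_pos.2 hpos).ne'
  have hat : ENNReal.ofReal a ≠ ⊤ := ENNReal.ofReal_ne_top
  have has0 : ENNReal.ofReal a ^ s ≠ 0 := by simp [ENNReal.rpow_eq_zero_iff, ha0, hat]
  have hast : ENNReal.ofReal a ^ s ≠ ⊤ := ENNReal.rpow_ne_top_of_nonneg hs.le hat
  rw [ENNReal.ofReal_mul ha, ENNReal.ofReal_mul ha, ENNReal.mul_rpow_of_nonneg _ _ h1s.le,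
    ENNReal.rpow_neg, ENNReal.rpow_neg, ENNReal.mul_rpow_of_nonneg _ _ hs.le,
    ENNReal.mul_inv (Or.inl has0) (Or.inl hast),
    ENNReal.rpow_add_of_nonneg _ _ zero_le_one hs.le, ENNReal.rpow_one]
  calc _ = ENNReal.ofReal a * (ENNReal.ofReal a ^ s * (ENNReal.ofReal a ^ s)⁻¹) *
        (ENNReal.ofReal b ^ (1 + s) * (ENNReal.ofReal q ^ s)⁻¹) := by ring
    _ = _ := by rw [ENNReal.mul_inv_cancel has0 hast, mul_one]

theorem IsDist.sum_ofReal {α : Type} [Fintype α] {p : α → ℝ} (hp : IsDist p) :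
    ∑ a, ENNReal.ofReal (p a) = 1 := by
  rw [← ENNReal.ofReal_sum_of_nonneg fun a _ => hp.1 a, hp.2, ENNReal.ofReal_one]

/-- one-shot channel resolvability: with `C = {X(w)}_{w∈𝒲}` i.i.d.
`∼ P_X` and `f_C(w) = X(w)`, for every `s ∈ (0,1]`, `P_W`, channel `P_{Y|X}` and `Q_Y`,
`exp(s·D_{1+s}(P_{Y|C}‖Q_Y|P_C)) ≤
  exp(s·D_{1+s}(P_{Y|X}‖Q_Y|P_X) - s·H_{1+s}(P_W)) + exp(s·D_{1+s}(P_Y‖Q_Y))`,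
all sides written in exponentiated form. -/
theorem one_shot_channel_resolvability
    (W X Y : Type) [Fintype W] [Fintype X] [Fintype Y]
    (PW : W → ℝ) (hPW : IsDist PW) (PX : X → ℝ) (hPX : IsDist PX)
    (PYX : X → Y → ℝ) (hPYX : IsKernel PYX) (QY : Y → ℝ) (hQY : IsDist QY)
    (s : ℝ) (hs0 : 0 < s) (hs1 : s ≤ 1) :
    rexp s
      (fun t : Y × (W → X) => (∏ w, PX (t.2 w)) * ∑ w, PW w * PYX (t.2 w) t.1)
      (fun t : Y × (W → X) => (∏ w, PX (t.2 w)) * QY t.1) ≤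
    rexp s (fun p : X × Y => PX p.1 * PYX p.1 p.2)
        (fun p : X × Y => PX p.1 * QY p.2) *
      rexp s PW (fun _ : W => (1 : ℝ)) +
    rexp s (fun y : Y => ∑ x, PX x * PYX x y) QY := by
  have hk (x : X) (y : Y) : 0 ≤ PYX x y := (hPYX x).1 y
  have hprod (c : W → X) : 0 ≤ ∏ w, PX (c w) := Finset.prod_nonneg fun w _ => hPX.1 _
  have hout (c : W → X) (y : Y) : ENNReal.ofReal (∑ w, PW w * PYX (c w) y) =
      ∑ w, ENNReal.ofReal (PW w) * ENNReal.ofReal (PYX (c w) y) := by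
    rw [ENNReal.ofReal_sum_of_nonneg fun w _ => mul_nonneg (hPW.1 w) (hk _ y)]
    exact Finset.sum_congr rfl fun w _ => ENNReal.ofReal_mul (hPW.1 w)
  have hmix (y : Y) : ENNReal.ofReal (∑ x, PX x * PYX x y) =
      ∑ x, ENNReal.ofReal (PX x) * ENNReal.ofReal (PYX x y) := by
    rw [ENNReal.ofReal_sum_of_nonneg fun x _ => mul_nonneg (hPX.1 x) (hk x y)]
    exact Finset.sum_congr rfl fun x _ => ENNReal.ofReal_mul (hPX.1 x)
  simp only [rexp, Fintype.sum_prod_type, ofReal_mul_rpow_mul_ofReal_mul_rpow (hprod _) _ _ hs0,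
    ofReal_mul_rpow_mul_ofReal_mul_rpow (hPX.1 _) _ _ hs0, hout, hmix, ENNReal.ofReal_one,
    ENNReal.one_rpow, mul_one, ENNReal.ofReal_prod_of_nonneg fun w _ => hPX.1 _]
  rw [Finset.sum_comm (γ := X), Finset.sum_mul, ← Finset.sum_add_distrib]
  gcongr with y
  simp only [← mul_assoc, ← Finset.sum_mul]
  rw [mul_right_comm, ← add_mul]
  gcongr
  exact sum_prod_mul_rpow_le _ hPX.sum_ofReal _ hPW.sum_ofReal
    (fun x => ENNReal.ofReal (PYX x y)) hs0 hs1

end
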